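/- For all real numbers z₁, z₂ > 1 with z₁ ≠ z₂, setting x_i = z_i + 1/z_i, the following identity holds, with both series on the right converging absolutely: 1/((z₁ − z₂)²·(1 − z₁^{−2})·(1 − z₂^{−2})) − 1/(x₁ − x₂)² = Σ_{u₁,u₂ ≥ 0} ((2u₁+1)!·(2u₂+1)!)/(u₁!²·u₂!²·(u₁+u₂+1)) · x₁^{−2u₁−2}·x₂^{−2u₂−2} + Σ_{u₁,u₂ ≥ 1} ((2u₁)!·(2u₂)!·u₁·u₂)/(u₁!²·u₂!²·(u₁+u₂)) · x₁^{−2u₁−1}·x₂^{−2u₂−1}. -/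

import Mathlib

open Finset in
lemma cb_conv (n : ℕ) : ∑ p ∈ antidiagonal n, (Nat.centralBinom p.1 : ℝ) * Nat.centralBinom p.2 = 4 ^ n := by
  have key : ∀ n : ℕ, 2 * ∑ p ∈ antidiagonal n, (p.1 : ℝ) * ((Nat.centralBinom p.1 : ℝ) * Nat.centralBinom p.2)
      = n * ∑ p ∈ antidiagonal n, (Nat.centralBinom p.1 : ℝ) * Nat.centralBinom p.2 := by
    intro n
    have h1 : ∑ p ∈ antidiagonal n, (p.1 : ℝ) * ((Nat.centralBinom p.1 : ℝ) * Nat.centralBinom p.2)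
      = ∑ p ∈ antidiagonal n, (p.2 : ℝ) * ((Nat.centralBinom p.1 : ℝ) * Nat.centralBinom p.2) := by
      rw [← Finset.Nat.sum_antidiagonal_swap]
      refine Finset.sum_congr rfl fun p _ => ?_
      simp only [Prod.fst_swap, Prod.snd_swap]; ring
    rw [two_mul]
    nth_rewrite 2 [h1]
    rw [← Finset.sum_add_distrib, Finset.mul_sum]
    refine Finset.sum_congr rfl fun p hp => ?_
    rw [← Finset.HasAntidiagonal.mem_antidiagonal.1 hp]; push_cast; ring
  induction n with
  | zero => simp
  | succ n ih =>
    have h := key (n + 1)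
    rw [Finset.Nat.sum_antidiagonal_succ] at h
    have h2 : ∑ p ∈ antidiagonal n, (((p.1 + 1 : ℕ) : ℝ) * ((Nat.centralBinom (p.1 + 1) : ℝ) * Nat.centralBinom p.2))
        = 4 * ∑ p ∈ antidiagonal n, (p.1 : ℝ) * ((Nat.centralBinom p.1 : ℝ) * Nat.centralBinom p.2)
         + 2 * ∑ p ∈ antidiagonal n, (Nat.centralBinom p.1 : ℝ) * Nat.centralBinom p.2 := by
      rw [Finset.mul_sum, Finset.mul_sum, ← Finset.sum_add_distrib]
      refine Finset.sum_congr rfl fun p _ => ?_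
      have := Nat.succ_mul_centralBinom_succ p.1
      have h3 : (((p.1 + 1 : ℕ) : ℝ) * (Nat.centralBinom (p.1 + 1) : ℝ)) = 2 * (2 * p.1 + 1) * Nat.centralBinom p.1 := by
        exact_mod_cast this
      rw [← mul_assoc, h3]; ring
    have h4 := key n
    simp only [h2] at h
    rw [ih] at h h4
    have hn : ((n : ℝ) + 1) ≠ 0 := by positivity
    apply mul_left_cancel₀ hn
    push_cast at h
    rw [← h]
    rw [pow_succ]
    linear_combination 4 * h4

lemma cb_hasSum (y s : ℝ) (hy : 0 ≤ y) (hs : 0 < s) (h : s ^ 2 * (1 - 4 * y) = 1) :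
    HasSum (fun n : ℕ => (Nat.centralBinom n : ℝ) * y ^ n) s := by
  have hlt : 4 * y < 1 := by
    by_contra hc
    push Not at hc
    nlinarith [sq_nonneg s]
  have hsum : Summable (fun n : ℕ => (Nat.centralBinom n : ℝ) * y ^ n) := by
    refine Summable.of_nonneg_of_le (fun n => by positivity) (fun n => ?_)
      (summable_geometric_of_lt_one (by positivity) hlt)
    rw [mul_pow]
    have : (Nat.centralBinom n : ℝ) ≤ 4 ^ n := by exact_mod_cast Nat.centralBinom_le_four_pow n
    gcongr
  have hn : Summable (fun n : ℕ => ‖(Nat.centralBinom n : ℝ) * y ^ n‖) := hsum.norm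
  have hp := tsum_mul_tsum_eq_tsum_sum_antidiagonal_of_summable_norm hn hn
  have h2 : ∀ n : ℕ, ∑ p ∈ Finset.HasAntidiagonal.antidiagonal n, ((Nat.centralBinom p.1 : ℝ) * y ^ p.1) *
      ((Nat.centralBinom p.2 : ℝ) * y ^ p.2) = (4 * y) ^ n := by
    intro n
    rw [mul_pow, ← cb_conv, Finset.sum_mul]
    refine Finset.sum_congr rfl fun p hp => ?_
    rw [← Finset.HasAntidiagonal.mem_antidiagonal.1 hp, pow_add]; ring
  simp only [h2] at hp
  rw [tsum_geometric_of_lt_one (by positivity) hlt] at hp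
  have h0 : 0 ≤ ∑' n : ℕ, (Nat.centralBinom n : ℝ) * y ^ n := tsum_nonneg fun n => by positivity
  have : ∑' n : ℕ, (Nat.centralBinom n : ℝ) * y ^ n = s := by
    have h1 : (1 - 4 * y)⁻¹ = s ^ 2 := by
      rw [inv_eq_iff_eq_inv]; exact eq_inv_of_mul_eq_one_right h
    rw [h1, ← sq] at hp
    exact (pow_left_inj₀ h0 hs.le two_ne_zero).1 hp
  rw [← this]; exact hsum.hasSum

lemma h_hasSum (w a : ℝ) (hw : 0 < w) (hw1 : w < 1) (ha : a = w / (1 + w ^ 2)) (k : ℕ) :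
    HasSum (fun m : ℕ => ((k + 2 * m).choose m : ℝ) * a ^ (k + 2 * m + 1)) (w ^ (k + 1) / (1 - w ^ 2)) := by
  have hd : 0 < 1 - w ^ 2 := by nlinarith
  have ha0 : 0 < a := by rw [ha]; positivity
  have h0 : HasSum (fun m : ℕ => ((0 + 2 * m).choose m : ℝ) * a ^ (0 + 2 * m + 1)) (w ^ (0 + 1) / (1 - w ^ 2)) := by
    have := (cb_hasSum (a ^ 2) ((1 + w ^ 2) / (1 - w ^ 2)) (by positivity) (by positivity)
      (by rw [ha]; field_simp; ring)).mul_left a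
    convert! this using 1
    · funext m; simp only [Nat.centralBinom, zero_add]; rw [← pow_mul]; ring
    · rw [ha]; field_simp; ring
  have h1 : HasSum (fun m : ℕ => ((1 + 2 * m).choose m : ℝ) * a ^ (1 + 2 * m + 1)) (w ^ (1 + 1) / (1 - w ^ 2)) := by
    have := ((hasSum_nat_add_iff' 1).2 h0).mul_left (1 / (2 * a))
    convert! this using 1
    · funext m
      have e : ((0 + 2 * (m + 1)).choose (m + 1) : ℝ) = 2 * ((1 + 2 * m).choose m : ℝ) := by
        have e1 : (0 + 2 * (m + 1)).choose (m + 1) = 2 * (1 + 2 * m).choose m := by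
          rw [show 0 + 2 * (m + 1) = (1 + 2 * m) + 1 by ring, Nat.choose_succ_succ,
            Nat.choose_symm_of_eq_add (show 1 + 2 * m = (m + 1) + m by ring)]
          ring
        exact_mod_cast e1
      rw [e]
      field_simp
      ring
    · simp
      have : 1 - w ^ 2 ≠ 0 := hd.ne'
      rw [ha]; field_simp; ring
  suffices H : _ ∧ HasSum (fun m : ℕ => ((k + 1 + 2 * m).choose m : ℝ) * a ^ (k + 1 + 2 * m + 1)) (w ^ (k + 1 + 1) / (1 - w ^ 2)) from H.1
  induction k with
  | zero => exact ⟨h0, h1⟩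
  | succ k ih =>
    refine ⟨ih.2, ?_⟩
    have := (((hasSum_nat_add_iff' 1).2 ih.2).mul_left (1 / a)).sub ((hasSum_nat_add_iff' 1).2 ih.1)
    convert! this using 1
    · funext m
      have e : ((k + 1 + 2 * (m + 1)).choose (m + 1) : ℝ) = ((k + 1 + 1 + 2 * m).choose m : ℝ)
          + (k + 2 * (m + 1)).choose (m + 1) := by
        rw [show k + 1 + 2 * (m + 1) = (k + 1 + 1 + 2 * m) + 1 by ring, Nat.choose_succ_succ,
            show k + 2 * (m + 1) = k + 1 + 1 + 2 * m by ring]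
        push_cast; ring
      rw [e]
      field_simp
      ring
    · simp
      have : 1 - w ^ 2 ≠ 0 := hd.ne'
      have e3 : 1 / a * w = 1 + w ^ 2 := by rw [ha]; field_simp
      have e4 : a⁻¹ * a = 1 := by field_simp
      rw [one_div] at e3
      field_simp
      field_simp at e3
      have hwa : w = (1 + w ^ 2) * a := by rw [ha]; field_simp
      linear_combination (-w ^ (k+1)) * hwa

/-- the finite telescoping identity -/
lemma fin_id (e U V J : ℕ) :
    (((U : ℝ) + V + e) * ∑ j ∈ Finset.range J, (if j ≤ U ∧ j ≤ V then
      ((2 * j + e : ℝ)) * ((2 * U + e).choose (U - j) : ℝ) * ((2 * V + e).choose (V - j) : ℝ) else 0))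
    = ((U : ℝ) + e) * (V + e) * ((2 * U + e).choose U : ℝ) * ((2 * V + e).choose V : ℝ) -
      (if J ≤ U ∧ J ≤ V then ((U : ℝ) + e + J) * (V + e + J) * ((2 * U + e).choose (U - J) : ℝ)
        * ((2 * V + e).choose (V - J) : ℝ) else 0) := by
  have step : ∀ U J : ℕ, J + 1 ≤ U → ((U : ℝ) + e + (J + 1)) * ((2 * U + e).choose (U - (J + 1)) : ℝ)
      = ((U : ℝ) - J) * ((2 * U + e).choose (U - J) : ℝ) := by
    intro U J h
    obtain ⟨d, rfl⟩ := Nat.exists_eq_add_of_le h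
    have := Nat.choose_succ_right_eq (2 * (J + 1 + d) + e) d
    rw [show J + 1 + d - (J + 1) = d by omega, show J + 1 + d - J = d + 1 by omega]
    rw [show 2 * (J + 1 + d) + e - d = (J + 1 + d) + e + (J + 1) by omega] at this
    have h' : (((2 * (J + 1 + d) + e).choose (d + 1) : ℝ)) * (d + 1) = ((2 * (J + 1 + d) + e).choose d : ℝ) * ((J + 1 + d) + e + (J + 1)) := by
      exact_mod_cast this
    push_cast
    linear_combination -h'
  induction J with
  | zero => simp
  | succ J ih =>
    rw [Finset.sum_range_succ, mul_add, ih]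
    by_cases h : J ≤ U ∧ J ≤ V
    · rw [if_pos h, if_pos h]
      by_cases h' : J + 1 ≤ U ∧ J + 1 ≤ V
      · rw [if_pos h']
        have hA := step U J h'.1
        have hB := step V J h'.2
        push_cast
        linear_combination (((V : ℝ) + e + (J + 1)) * ((2 * V + e).choose (V - (J + 1)) : ℝ)) * hA + (((U : ℝ) - J) * ((2 * U + e).choose (U - J) : ℝ)) * hB
      · rw [if_neg h']
        have : (U : ℝ) = J ∨ (V : ℝ) = J := by
          have : U = J ∨ V = J := by omega
          exact_mod_cast this
        rcases this with hh | hh <;> rw [hh] <;> ring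
    · rw [if_neg h, if_neg h, if_neg (by omega)]; ring

lemma main_sum (w₁ w₂ a b : ℝ) (hw₁ : 0 < w₁) (hw₁' : w₁ < 1) (hw₂ : 0 < w₂) (hw₂' : w₂ < 1)
    (ha : a = w₁ / (1 + w₁ ^ 2)) (hb : b = w₂ / (1 + w₂ ^ 2)) (e : ℕ) (he : 0 < e) :
    HasSum (fun u : ℕ × ℕ => ((u.1 : ℝ) + e) * (u.2 + e) * ((2 * u.1 + e).choose u.1 : ℝ) *
      ((2 * u.2 + e).choose u.2 : ℝ) / ((u.1 : ℝ) + u.2 + e) * a ^ (2 * u.1 + e + 1) * b ^ (2 * u.2 + e + 1))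
      ((2 * (w₁ * w₂) ^ 2 / (1 - (w₁ * w₂) ^ 2) ^ 2 + e / (1 - (w₁ * w₂) ^ 2)) *
        ((w₁ * w₂) ^ (e + 1) / ((1 - w₁ ^ 2) * (1 - w₂ ^ 2)))) := by
  have ha0 : 0 < a := by rw [ha]; positivity
  have hb0 : 0 < b := by rw [hb]; positivity
  have hd₁ : 0 < 1 - w₁ ^ 2 := by nlinarith
  have hd₂ : 0 < 1 - w₂ ^ 2 := by nlinarith
  set g : ℕ × (ℕ × ℕ) → ℝ := fun p => if p.1 ≤ p.2.1 ∧ p.1 ≤ p.2.2 then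
      ((2 * p.1 + e : ℝ)) * ((2 * p.2.1 + e).choose (p.2.1 - p.1) : ℝ) *
        ((2 * p.2.2 + e).choose (p.2.2 - p.1) : ℝ) * (a ^ (2 * p.2.1 + e + 1) * b ^ (2 * p.2.2 + e + 1))
      else 0 with hg
  set φ : ℕ × (ℕ × ℕ) → ℕ × (ℕ × ℕ) := fun p => (p.1, (p.2.1 + p.1, p.2.2 + p.1)) with hφ
  have hinj : Function.Injective φ := by
    rintro ⟨j, m, n⟩ ⟨jj, mm, nn⟩ h
    simp only [hφ, Prod.mk.injEq] at h ⊢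
    omega
  have hsupp : ∀ x, x ∉ Set.range φ → g x = 0 := by
    rintro ⟨j, u, v⟩ hx
    simp only [hg]
    rw [if_neg]
    rintro ⟨h1, h2⟩
    apply hx
    refine ⟨(j, (u - j, v - j)), ?_⟩
    simp only [hφ, Prod.mk.injEq, true_and] at h1 h2 ⊢
    omega
  have hgφ : ∀ j m n : ℕ, g (φ (j, (m, n))) = (2 * j + e : ℝ) *
      ((((2 * j + e + 2 * m).choose m : ℝ) * a ^ (2 * j + e + 2 * m + 1)) *
       (((2 * j + e + 2 * n).choose n : ℝ) * b ^ (2 * j + e + 2 * n + 1))) := by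
    intro j m n
    simp only [hg, hφ]
    rw [if_pos (by omega)]
    rw [show 2 * (m + j) + e = 2 * j + e + 2 * m by ring, show 2 * (n + j) + e = 2 * j + e + 2 * n by ring,
      Nat.add_sub_cancel, Nat.add_sub_cancel]
    ring
  have hnn : 0 ≤ g ∘ φ := by
    rintro ⟨j, m, n⟩
    simp only [Function.comp, hgφ, Pi.zero_apply]
    positivity
  have hfib : ∀ j : ℕ, HasSum (fun q : ℕ × ℕ => (g ∘ φ) (j, q))
      ((2 * j + e : ℝ) * (w₁ ^ (2 * j + e + 1) / (1 - w₁ ^ 2) * (w₂ ^ (2 * j + e + 1) / (1 - w₂ ^ 2)))) := by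
    intro j
    have A := h_hasSum w₁ a hw₁ hw₁' ha (2 * j + e)
    have B := h_hasSum w₂ b hw₂ hw₂' hb (2 * j + e)
    have C := A.summable.mul_of_nonneg B.summable (fun m => by positivity) (fun m => by positivity)
    have D := (A.mul B C).mul_left (2 * j + e : ℝ)
    convert! D using 1
    funext ⟨m, n⟩
    exact hgφ j m n
  set r := (w₁ * w₂) ^ 2 with hr
  have hw12 : w₁ * w₂ < 1 := by nlinarith
  have hr1 : r < 1 := by rw [hr]; have : 0 < w₁ * w₂ := by positivity
                         nlinarith
  have hr0 : 0 ≤ r := by positivity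
  have houter : HasSum (fun j : ℕ => (2 * j + e : ℝ) * (w₁ ^ (2 * j + e + 1) / (1 - w₁ ^ 2) * (w₂ ^ (2 * j + e + 1) / (1 - w₂ ^ 2))))
      ((2 * r / (1 - r) ^ 2 + e / (1 - r)) *
        ((w₁ * w₂) ^ (e + 1) / ((1 - w₁ ^ 2) * (1 - w₂ ^ 2)))) := by
    have A := (hasSum_coe_mul_geometric_of_norm_lt_one (r := r) (by rwa [Real.norm_of_nonneg hr0])).mul_left 2
    have B := (hasSum_geometric_of_lt_one hr0 hr1).mul_left (e : ℝ)
    have D := (A.add B).mul_right ((w₁ * w₂) ^ (e + 1) / ((1 - w₁ ^ 2) * (1 - w₂ ^ 2)))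
    convert! D using 1
    · funext j
      rw [hr, ← pow_mul]
      field_simp
      ring
    · ring
  have hS : Summable (g ∘ φ) := by
    rw [summable_prod_of_nonneg hnn]
    refine ⟨fun j => (hfib j).summable, ?_⟩
    refine houter.summable.congr fun j => ?_
    exact (hfib j).tsum_eq.symm
  have hT : HasSum (g ∘ φ) ((2 * r / (1 - r) ^ 2 + e / (1 - r)) *
        ((w₁ * w₂) ^ (e + 1) / ((1 - w₁ ^ 2) * (1 - w₂ ^ 2)))) := by
    have := hS.hasSum.prod_fiberwise hfib
    rw [← this.unique houter]
    exact hS.hasSum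
  rw [hinj.hasSum_iff hsupp] at hT
  rw [← (Equiv.prodComm (ℕ × ℕ) ℕ).hasSum_iff] at hT
  refine hT.prod_fiberwise ?_
  rintro ⟨u, v⟩
  have hfin : HasSum (fun j => g (j, (u, v))) (∑ j ∈ Finset.range (u + 1), g (j, (u, v))) := hasSum_sum_of_ne_finset_zero (f := fun j => g (j, (u, v))) (s := Finset.range (u + 1)) (by
    intro j hj
    simp only [Finset.mem_range] at hj
    simp only [hg]
    rw [if_neg]
    omega)
  have hF := fin_id e u v (u + 1)
  rw [if_neg (by omega), sub_zero] at hF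
  have hne : ((u : ℝ) + v + e) ≠ 0 := by positivity
  convert! hfin using 1
  dsimp only
  rw [← hF, mul_div_cancel_left₀ _ hne, mul_assoc, Finset.sum_mul]
  refine Finset.sum_congr rfl fun j _ => ?_
  simp only [hg, ite_mul, zero_mul]


/-- The regularized genus-zero two-point expansion for the curve `x = z + 1/z`:
for `z₁, z₂ > 1`, `z₁ ≠ z₂`, `xᵢ = zᵢ + 1/zᵢ`,
`1/((z₁−z₂)²(1−z₁⁻²)(1−z₂⁻²)) − 1/(x₁−x₂)²
  = Σ_{u₁,u₂≥0} (2u₁+1)!(2u₂+1)!/(u₁!²u₂!²(u₁+u₂+1)) x₁^{−2u₁−2} x₂^{−2u₂−2}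
  + Σ_{u₁,u₂≥1} (2u₁)!(2u₂)!u₁u₂/(u₁!²u₂!²(u₁+u₂)) x₁^{−2u₁−1} x₂^{−2u₂−1}`,
with both series absolutely convergent. -/
theorem stmt_12 (z₁ z₂ x₁ x₂ : ℝ) (h₁ : 1 < z₁) (h₂ : 1 < z₂) (hne : z₁ ≠ z₂)
    (hx₁ : x₁ = z₁ + 1 / z₁) (hx₂ : x₂ = z₂ + 1 / z₂) :
    Summable (fun u : ℕ × ℕ =>
      |(((2 * u.1 + 1).factorial : ℝ) * ((2 * u.2 + 1).factorial : ℝ)) /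
          ((u.1.factorial : ℝ) ^ 2 * (u.2.factorial : ℝ) ^ 2 * ((u.1 : ℝ) + u.2 + 1)) *
          x₁⁻¹ ^ (2 * u.1 + 2) * x₂⁻¹ ^ (2 * u.2 + 2)|) ∧
    Summable (fun u : ℕ × ℕ =>
      |(((2 * (u.1 + 1)).factorial : ℝ) * ((2 * (u.2 + 1)).factorial : ℝ) *
            ((u.1 : ℝ) + 1) * ((u.2 : ℝ) + 1)) /
          (((u.1 + 1).factorial : ℝ) ^ 2 * ((u.2 + 1).factorial : ℝ) ^ 2 *
            (((u.1 : ℝ) + 1) + ((u.2 : ℝ) + 1))) *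
          x₁⁻¹ ^ (2 * (u.1 + 1) + 1) * x₂⁻¹ ^ (2 * (u.2 + 1) + 1)|) ∧
    1 / ((z₁ - z₂) ^ 2 * (1 - (z₁ ^ 2)⁻¹) * (1 - (z₂ ^ 2)⁻¹)) - 1 / (x₁ - x₂) ^ 2
      = (∑' u : ℕ × ℕ,
          (((2 * u.1 + 1).factorial : ℝ) * ((2 * u.2 + 1).factorial : ℝ)) /
            ((u.1.factorial : ℝ) ^ 2 * (u.2.factorial : ℝ) ^ 2 * ((u.1 : ℝ) + u.2 + 1)) *
            x₁⁻¹ ^ (2 * u.1 + 2) * x₂⁻¹ ^ (2 * u.2 + 2)) +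
        (∑' u : ℕ × ℕ,
          (((2 * (u.1 + 1)).factorial : ℝ) * ((2 * (u.2 + 1)).factorial : ℝ) *
              ((u.1 : ℝ) + 1) * ((u.2 : ℝ) + 1)) /
            (((u.1 + 1).factorial : ℝ) ^ 2 * ((u.2 + 1).factorial : ℝ) ^ 2 *
              (((u.1 : ℝ) + 1) + ((u.2 : ℝ) + 1))) *
            x₁⁻¹ ^ (2 * (u.1 + 1) + 1) * x₂⁻¹ ^ (2 * (u.2 + 1) + 1)) := by
  have hz₁ : 0 < z₁ := by linarith
  have hz₂ : 0 < z₂ := by linarith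
  have ha : x₁⁻¹ = z₁⁻¹ / (1 + z₁⁻¹ ^ 2) := by rw [hx₁]; field_simp
  have hb : x₂⁻¹ = z₂⁻¹ / (1 + z₂⁻¹ ^ 2) := by rw [hx₂]; field_simp
  have M := main_sum z₁⁻¹ z₂⁻¹ x₁⁻¹ x₂⁻¹ (by positivity) (inv_lt_one_of_one_lt₀ h₁) (by positivity)
    (inv_lt_one_of_one_lt₀ h₂) ha hb
  have M1 := M 1 one_pos
  have M2 := M 2 two_pos
  have c1 : ∀ u : ℕ, ((u : ℝ) + (1 : ℕ)) * ((2 * u + 1).choose u : ℝ)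
      = ((2 * u + 1).factorial : ℝ) / (u.factorial : ℝ) ^ 2 := by
    intro u
    rw [Nat.cast_choose ℝ (by omega : u ≤ 2 * u + 1), show 2 * u + 1 - u = u + 1 by omega,
      Nat.factorial_succ u]
    push_cast
    field_simp
  have c2 : ∀ u : ℕ, ((u : ℝ) + (2 : ℕ)) * ((2 * u + 2).choose u : ℝ)
      = ((2 * (u + 1)).factorial : ℝ) * ((u : ℝ) + 1) / ((u + 1).factorial : ℝ) ^ 2 := by
    intro u
    rw [Nat.cast_choose ℝ (by omega : u ≤ 2 * u + 2), show 2 * u + 2 - u = u + 1 + 1 by omega,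
      Nat.factorial_succ (u + 1), Nat.factorial_succ u, show 2 * (u + 1) = 2 * u + 2 by ring]
    push_cast
    field_simp
    ring
  have e1 : ∀ u : ℕ × ℕ, ((u.1 : ℝ) + (1 : ℕ)) * (u.2 + (1 : ℕ)) * ((2 * u.1 + 1).choose u.1 : ℝ) *
      ((2 * u.2 + 1).choose u.2 : ℝ) / ((u.1 : ℝ) + u.2 + (1 : ℕ)) * x₁⁻¹ ^ (2 * u.1 + 1 + 1)
        * x₂⁻¹ ^ (2 * u.2 + 1 + 1)
      = (((2 * u.1 + 1).factorial : ℝ) * ((2 * u.2 + 1).factorial : ℝ)) /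
          ((u.1.factorial : ℝ) ^ 2 * (u.2.factorial : ℝ) ^ 2 * ((u.1 : ℝ) + u.2 + 1)) *
          x₁⁻¹ ^ (2 * u.1 + 2) * x₂⁻¹ ^ (2 * u.2 + 2) := by
    intro u
    rw [mul_right_comm ((u.1 : ℝ) + (1 : ℕ)), c1, mul_assoc (_ / _) (_ + _) (_ : ℝ), c1, div_mul_div_comm, div_div,
      Nat.cast_one]
  have e2 : ∀ u : ℕ × ℕ, ((u.1 : ℝ) + (2 : ℕ)) * (u.2 + (2 : ℕ)) * ((2 * u.1 + 2).choose u.1 : ℝ) *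
      ((2 * u.2 + 2).choose u.2 : ℝ) / ((u.1 : ℝ) + u.2 + (2 : ℕ)) * x₁⁻¹ ^ (2 * u.1 + 2 + 1)
        * x₂⁻¹ ^ (2 * u.2 + 2 + 1)
      = (((2 * (u.1 + 1)).factorial : ℝ) * ((2 * (u.2 + 1)).factorial : ℝ) *
            ((u.1 : ℝ) + 1) * ((u.2 : ℝ) + 1)) /
          (((u.1 + 1).factorial : ℝ) ^ 2 * ((u.2 + 1).factorial : ℝ) ^ 2 *
            (((u.1 : ℝ) + 1) + ((u.2 : ℝ) + 1))) *
          x₁⁻¹ ^ (2 * (u.1 + 1) + 1) * x₂⁻¹ ^ (2 * (u.2 + 1) + 1) := by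
    intro u
    rw [mul_right_comm ((u.1 : ℝ) + (2 : ℕ)), c2, mul_assoc (_ / _) (_ + _) (_ : ℝ), c2, div_mul_div_comm, div_div]
    congr 2
    congr 1
    · ring
    · push_cast; ring
  simp only [e1] at M1
  simp only [e2] at M2
  refine ⟨M1.summable.abs, M2.summable.abs, ?_⟩
  rw [M1.tsum_eq, M2.tsum_eq, hx₁, hx₂]
  have hd : z₁ - z₂ ≠ 0 := sub_ne_zero.2 hne
  have hp : z₁ * z₂ - 1 ≠ 0 := by nlinarith
  have hp' : z₁ * z₂ + 1 ≠ 0 := by positivity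
  have hq₁ : z₁ ^ 2 - 1 ≠ 0 := by nlinarith
  have hq₂ : z₂ ^ 2 - 1 ≠ 0 := by nlinarith
  have f1 : 1 - (z₁ ^ 2)⁻¹ = (z₁ ^ 2 - 1) / z₁ ^ 2 := by field_simp
  have f2 : 1 - (z₂ ^ 2)⁻¹ = (z₂ ^ 2 - 1) / z₂ ^ 2 := by field_simp
  have f3 : z₁ + 1 / z₁ - (z₂ + 1 / z₂) = (z₁ - z₂) * (z₁ * z₂ - 1) / (z₁ * z₂) := by
    field_simp; ring
  have f4 : 1 - (z₁⁻¹ * z₂⁻¹) ^ 2 = (z₁ * z₂ - 1) * (z₁ * z₂ + 1) / (z₁ * z₂) ^ 2 := by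
    field_simp; ring
  rw [inv_pow, inv_pow, f1, f2, f3, f4]
  simp only [Nat.reduceAdd, ← mul_inv, inv_pow]
  field_simp
  push_cast
  ring
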